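/- For any invertible n×n matrices φ, ψ, χ over A and all τ, σ ∈ Der: P₂(ψ,χ)(τ,σ) − P₂(φ·ψ, χ)(τ,σ) + P₂(φ, ψ·χ)(τ,σ) − P₂(φ,ψ)(τ,σ) = 0. (Section 3.5: the Čech coboundary of the 2-cochain p₂(φ) = (1/2)tr{φ_{jk}⁻¹φ_{ij}⁻¹ dφ_{ij} dφ_{jk}} attached to a 1-cocycle φ vanishes, d_Čech p₂(φ) = 0.) -/

import Mathlib

noncomputable section

variable (k A : Type*) [Field k] [CharZero k] [CommRing A] [Algebra k A]

/-- Entrywise application of a derivation to a matrix. -/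
def dmat {n : ℕ} (τ : Derivation k A A) (φ : Matrix (Fin n) (Fin n) A) :
    Matrix (Fin n) (Fin n) A :=
  Matrix.of fun p q => τ (φ p q)

/-- One half, as an element of `A`. -/
def half : A := algebraMap k A 2⁻¹

/-- `P₂(φ,ψ)(τ,σ) := ½[tr(ψ⁻¹φ⁻¹τ(φ)σ(ψ)) − tr(ψ⁻¹φ⁻¹σ(φ)τ(ψ))]`,
the 2-form `½ tr{ψ⁻¹φ⁻¹ dφ dψ}` evaluated on `(τ,σ)`. -/
def P2 {n : ℕ} (φ ψ : Matrix (Fin n) (Fin n) A) (τ σ : Derivation k A A) : A :=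
  half k A * (Matrix.trace (ψ⁻¹ * φ⁻¹ * dmat k A τ φ * dmat k A σ ψ)
    - Matrix.trace (ψ⁻¹ * φ⁻¹ * dmat k A σ φ * dmat k A τ ψ))

/-- `p₃(φ)(τ₁,τ₂,τ₃) := (1/6)·Σ_{π∈S₃} sgn(π)·tr(N_{π(1)} N_{π(2)} N_{π(3)})`
with `N_i = φ⁻¹·τ_i(φ)`; the 3-form `(1/6)tr{(φ⁻¹dφ)³}` evaluated on `(τ₁,τ₂,τ₃)`. -/
def p3 {n : ℕ} (φ : Matrix (Fin n) (Fin n) A) (τ₁ τ₂ τ₃ : Derivation k A A) : A :=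
  algebraMap k A 6⁻¹ *
    ∑ π : Equiv.Perm (Fin 3), (Equiv.Perm.sign π : ℤ) •
      Matrix.trace ((φ⁻¹ * dmat k A (![τ₁, τ₂, τ₃] (π 0)) φ) *
        (φ⁻¹ * dmat k A (![τ₁, τ₂, τ₃] (π 1)) φ) *
        (φ⁻¹ * dmat k A (![τ₁, τ₂, τ₃] (π 2)) φ))

/-- The cochain `p₂(φ,g)` of Section 3.5 (with `g = g_i`, `h = g_j`), evaluated on `(τ,σ)`. -/
def Qc {n : ℕ} (φ g h : Matrix (Fin n) (Fin n) A) (τ σ : Derivation k A A) : A :=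
  half k A * (Matrix.trace (φ⁻¹ * g⁻¹ * dmat k A τ g * φ * h⁻¹ * dmat k A σ h)
    - Matrix.trace (φ⁻¹ * g⁻¹ * dmat k A σ g * φ * h⁻¹ * dmat k A τ h)
    + Matrix.trace (φ⁻¹ * dmat k A τ φ * h⁻¹ * dmat k A σ h)
    - Matrix.trace (φ⁻¹ * dmat k A σ φ * h⁻¹ * dmat k A τ h)
    - Matrix.trace (g⁻¹ * dmat k A τ g * dmat k A σ φ * φ⁻¹)
    + Matrix.trace (g⁻¹ * dmat k A σ g * dmat k A τ φ * φ⁻¹))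

theorem dmat_mul {n : ℕ} (τ : Derivation k A A) (φ ψ : Matrix (Fin n) (Fin n) A) :
    dmat k A τ (φ * ψ) = dmat k A τ φ * ψ + φ * dmat k A τ ψ := by
  ext p q
  simp only [dmat, Matrix.of_apply, Matrix.mul_apply, Matrix.add_apply, map_sum,
    Derivation.leibniz, smul_eq_mul, ← Finset.sum_add_distrib]
  exact Finset.sum_congr rfl fun _ _ => by ring

/-- The bilinear expression `tr{ψ⁻¹φ⁻¹ τ(φ) σ(ψ)}` is already a Čech cocycle, before
antisymmetrization in `τ` and `σ`. -/
theorem trace_cech_cocycle {n : ℕ} (φ ψ χ : Matrix (Fin n) (Fin n) A)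
    (hφ : IsUnit φ) (hχ : IsUnit χ) (τ σ : Derivation k A A) :
    Matrix.trace (χ⁻¹ * ψ⁻¹ * dmat k A τ ψ * dmat k A σ χ)
      + Matrix.trace ((ψ * χ)⁻¹ * φ⁻¹ * dmat k A τ φ * dmat k A σ (ψ * χ))
      = Matrix.trace (χ⁻¹ * (φ * ψ)⁻¹ * dmat k A τ (φ * ψ) * dmat k A σ χ)
      + Matrix.trace (ψ⁻¹ * φ⁻¹ * dmat k A τ φ * dmat k A σ ψ) := by
  have hφ' : φ⁻¹ * φ = 1 := Matrix.nonsing_inv_mul φ ((Matrix.isUnit_iff_isUnit_det φ).mp hφ)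
  have hχ' : χ * χ⁻¹ = 1 := Matrix.mul_nonsing_inv χ ((Matrix.isUnit_iff_isUnit_det χ).mp hχ)
  have cancel_left : χ⁻¹ * (φ * ψ)⁻¹ * (φ * dmat k A τ ψ) * dmat k A σ χ
      = χ⁻¹ * ψ⁻¹ * dmat k A τ ψ * dmat k A σ χ := by
    rw [Matrix.mul_inv_rev]
    calc _ = χ⁻¹ * ψ⁻¹ * (φ⁻¹ * φ) * dmat k A τ ψ * dmat k A σ χ := by noncomm_ring
      _ = _ := by rw [hφ', mul_one]
  have cancel_cyclic : Matrix.trace ((ψ * χ)⁻¹ * φ⁻¹ * dmat k A τ φ * (dmat k A σ ψ * χ))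
      = Matrix.trace (ψ⁻¹ * φ⁻¹ * dmat k A τ φ * dmat k A σ ψ) := by
    rw [← mul_assoc, Matrix.trace_mul_comm, Matrix.mul_inv_rev]
    simp only [← mul_assoc]
    rw [hχ', one_mul]
  rw [dmat_mul, dmat_mul, mul_add, mul_add, add_mul, Matrix.trace_add, Matrix.trace_add,
    cancel_left, cancel_cyclic]
  simp only [Matrix.mul_inv_rev, mul_assoc]
  ring

/-- Section 3.5: the Čech coboundary of the 2-cochain `p₂(φ)` vanishes. -/
theorem cech_coboundary_p2 {n : ℕ} (hn : 0 < n)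
    (φ ψ χ : Matrix (Fin n) (Fin n) A)
    (hφ : IsUnit φ) (hψ : IsUnit ψ) (hχ : IsUnit χ)
    (τ σ : Derivation k A A) :
    P2 k A ψ χ τ σ - P2 k A (φ * ψ) χ τ σ + P2 k A φ (ψ * χ) τ σ - P2 k A φ ψ τ σ = 0 := by
  have hτσ := trace_cech_cocycle k A φ ψ χ hφ hχ τ σ
  have hστ := trace_cech_cocycle k A φ ψ χ hφ hχ σ τ
  simp only [P2]
  linear_combination half k A * (hτσ - hστ)
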